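/- Let d ≥ 1 and let S₁, …, S_d, T₁, …, T_d be 2d independent standard Gaussian random vectors in ℝ^d. Let B_S be the (ε/2)-neighborhood of the affine hull of {S₁, …, S_d} and B_T the (ε/2)-neighborhood of the affine hull of {T₁, …, T_d}. Then for every t ≥ 1, ℙ( 𝒢(B_S ∩ B_T) ≥ ε²·t/√(2π) ) ≤ 1/t^{d−2}. -/

import Mathlib

open MeasureTheory ProbabilityTheory

/-- The standard Gaussian probability measure on `ℝ^d`. -/
noncomputable def stdGaussian (d : ℕ) : Measure (EuclideanSpace ℝ (Fin d)) :=
  (Measure.pi fun _ : Fin d => gaussianReal 0 1).map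
    (MeasurableEquiv.toLp 2 (Fin d → ℝ))

open Module
open scoped RealInnerProductSpace

section OneDimensional

/-- The standard Gaussian measure of an interval is at most its length times `1 / √(2π)`. -/
lemma gaussianReal_Icc_le (a b : ℝ) :
    gaussianReal 0 1 (Set.Icc a b) ≤ ENNReal.ofReal ((b - a) / √(2 * Real.pi)) := by
  rw [gaussianReal_apply 0 one_ne_zero]
  calc ∫⁻ x in Set.Icc a b, gaussianPDF 0 1 x
      ≤ ∫⁻ _ in Set.Icc a b, ENNReal.ofReal (1 / √(2 * Real.pi)) := by
        refine lintegral_mono fun x ↦ ENNReal.ofReal_le_ofReal ?_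
        rw [gaussianPDFReal, ← one_div, NNReal.coe_one, mul_one]
        refine mul_le_of_le_one_right (by positivity) (Real.exp_le_one_iff.2 ?_)
        have := sq_nonneg (x - 0)
        linarith
    _ = ENNReal.ofReal ((b - a) / √(2 * Real.pi)) := by
        rw [setLIntegral_const, Real.volume_Icc, ← ENNReal.ofReal_mul (by positivity)]
        ring_nf

/-- The exponential moment of the square of a standard Gaussian variable. -/
lemma lintegral_exp_neg_mul_sq_gaussianReal {c : ℝ} (hc : 0 < 1 + 2 * c) :
    ∫⁻ x, ENNReal.ofReal (Real.exp (-c * x ^ 2)) ∂(gaussianReal 0 1) =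
      ENNReal.ofReal (1 / √(1 + 2 * c)) := by
  rw [gaussianReal_of_var_ne_zero 0 one_ne_zero,
    lintegral_withDensity_eq_lintegral_mul _ (measurable_gaussianPDF 0 1) (by fun_prop)]
  have h (x : ℝ) : (gaussianPDF 0 1 * fun x ↦ ENNReal.ofReal (Real.exp (-c * x ^ 2))) x =
      ENNReal.ofReal ((√(2 * Real.pi))⁻¹ * Real.exp (-((1 + 2 * c) / 2) * x ^ 2)) := by
    rw [Pi.mul_apply, gaussianPDF, gaussianPDFReal, ← ENNReal.ofReal_mul (by positivity),
      mul_assoc, ← Real.exp_add]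
    simp only [NNReal.coe_one, mul_one, sub_zero]
    ring_nf
  simp_rw [h]
  rw [← ofReal_integral_eq_lintegral_ofReal
    ((integrable_exp_neg_mul_sq (by positivity)).const_mul _)
    (.of_forall fun x ↦ by positivity), integral_const_mul, integral_gaussian]
  congr 1
  rw [← Real.sqrt_inv, ← Real.sqrt_mul (by positivity), one_div, ← Real.sqrt_inv]
  congr 1
  field_simp

end OneDimensional

section Geometry

/-- The condition that the sine of the angle between `u` and `v` is at most `1 / (√(2π) * t)`. -/
def NearlyParallel {E : Type*} [NormedAddCommGroup E] [InnerProductSpace ℝ E] (t : ℝ) (u v : E) :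
    Prop :=
  (1 - 1 / (2 * Real.pi * t ^ 2)) * (‖u‖ ^ 2 * ‖v‖ ^ 2) ≤ ⟪u, v⟫ ^ 2

lemma NearlyParallel.map {E : Type*} [NormedAddCommGroup E] [InnerProductSpace ℝ E] {t : ℝ}
    {u v : E} (h : NearlyParallel t u v) (A : E ≃ₗᵢ[ℝ] E) : NearlyParallel t (A u) (A v) := by
  simpa only [NearlyParallel, A.norm_map, A.inner_map_map] using h

lemma NearlyParallel.smul_right {E : Type*} [NormedAddCommGroup E] [InnerProductSpace ℝ E] {t : ℝ}
    {u v : E} (h : NearlyParallel t u v) (c : ℝ) : NearlyParallel t u (c • v) := by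
  rw [NearlyParallel] at h ⊢
  rw [norm_smul, real_inner_smul_right, mul_pow, mul_pow, Real.norm_eq_abs, sq_abs]
  nlinarith [mul_le_mul_of_nonneg_left h (sq_nonneg c)]

/-- The neighborhood of an affine span contained in a hyperplane lies in a slab. -/
lemma cthickening_affineSpan_subset_slab {E : Type*} [NormedAddCommGroup E]
    [InnerProductSpace ℝ E] {ι : Type*} [Nonempty ι] {S : ι → E} {u : E}
    (hu : ‖u‖ = 1) {a : ℝ} (hS : ∀ i, ⟪u, S i⟫ = a) {δ : ℝ} (hδ : 0 ≤ δ) :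
    Metric.cthickening δ (affineSpan ℝ (Set.range S) : Set E) ⊆ {x | |⟪u, x⟫ - a| ≤ δ} := by
  have hspan (y : E) (hy : y ∈ affineSpan ℝ (Set.range S)) : ⟪u, y⟫ = a := by
    refine affineSpan_induction hy (Set.forall_mem_range.2 hS) fun c x y z hx hy hz ↦ ?_
    rw [vadd_eq_add, vsub_eq_sub, inner_add_right, real_inner_smul_right, inner_sub_right,
      hx, hy, hz, sub_self, mul_zero, zero_add]
  intro x hx
  have hne : (affineSpan ℝ (Set.range S) : Set E).Nonempty :=
    (Set.range_nonempty S).mono (subset_affineSpan ℝ _)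
  refine ((Metric.le_infDist hne).2 fun y hy ↦ ?_).trans
    (ENNReal.toReal_le_of_le_ofReal hδ hx)
  rw [← hspan y hy, ← inner_sub_right, dist_eq_norm]
  simpa [hu] using abs_real_inner_le_norm u (x - y)

end Geometry

section StandardGaussian

variable {E : Type*} [NormedAddCommGroup E] [InnerProductSpace ℝ E] [FiniteDimensional ℝ E]

lemma exists_orthonormalBasis_apply_eq {u : E} (hu : ‖u‖ = 1) (i : Fin (finrank ℝ E)) :
    ∃ b : OrthonormalBasis (Fin (finrank ℝ E)) ℝ E, b i = u := by
  have hv : Orthonormal ℝ (({i} : Set (Fin (finrank ℝ E))).domRestrict fun _ ↦ u) :=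
    ⟨fun _ ↦ hu, fun x y hxy ↦ (hxy (Subsingleton.elim x y)).elim⟩
  obtain ⟨b, hb⟩ := hv.exists_orthonormalBasis_extension_of_card_eq (by simp)
  exact ⟨b, hb i rfl⟩

lemma exists_orthonormalBasis_apply_eq_apply_eq {u w : E} (hu : ‖u‖ = 1) (hw : ‖w‖ = 1)
    (huw : ⟪u, w⟫ = 0) {i j : Fin (finrank ℝ E)} (hij : i ≠ j) :
    ∃ b : OrthonormalBasis (Fin (finrank ℝ E)) ℝ E, b i = u ∧ b j = w := by
  have hv : Orthonormal ℝ (({i, j} : Set (Fin (finrank ℝ E))).domRestrict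
      fun k ↦ if k = i then u else w) := by
    constructor
    · rintro ⟨k, rfl | rfl⟩ <;> simp [hu, hw, hij.symm]
    · rintro ⟨k, rfl | rfl⟩ ⟨l, rfl | rfl⟩ hkl <;>
        simp_all [hij.symm, real_inner_comm]
  obtain ⟨b, hb⟩ := hv.exists_orthonormalBasis_extension_of_card_eq (by simp)
  exact ⟨b, by simpa using hb i (by simp), by simpa [hij.symm] using hb j (by simp)⟩

variable [MeasurableSpace E] [BorelSpace E]

lemma stdGaussian_hyperplane {u : E} (hu : u ≠ 0) :
    ProbabilityTheory.stdGaussian E {x | ⟪u, x⟫ = 0} = 0 := by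
  have hpos : 0 < finrank ℝ E := finrank_pos_iff_exists_ne_zero.2 ⟨u, hu⟩
  have hu' : ‖u‖ ≠ 0 := norm_ne_zero_iff.2 hu
  obtain ⟨b, hb⟩ := exists_orthonormalBasis_apply_eq (u := ‖u‖⁻¹ • u)
    (by simp [norm_smul, hu']) ⟨0, hpos⟩
  have := nullSingletonClass_gaussianReal (μ := 0) (v := 1) one_ne_zero
  have hmeas : MeasurableSet {x : E | ⟪u, x⟫ = 0} :=
    (isClosed_eq (by fun_prop) (by fun_prop)).measurableSet
  rw [stdGaussian_eq_map_pi_orthonormalBasis b, Measure.map_apply (by fun_prop) hmeas]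
  convert Measure.pi_hyperplane (fun _ : Fin (finrank ℝ E) ↦ gaussianReal 0 1) ⟨0, hpos⟩ 0 using 2
  ext x
  have : u = ‖u‖ • b ⟨0, hpos⟩ := by rw [hb, smul_smul, mul_inv_cancel₀ hu', one_smul]
  rw [Set.mem_preimage, Set.mem_ofPred_eq, this, real_inner_smul_left,
    b.orthonormal.inner_right_fintype]
  simp [hu']

lemma stdGaussian_submodule {p : Submodule ℝ E} (hp : p ≠ ⊤) :
    ProbabilityTheory.stdGaussian E p = 0 := by
  obtain ⟨u, hu, hu0⟩ := Submodule.exists_mem_ne_zero_of_ne_bot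
    (mt Submodule.orthogonal_eq_bot_iff.1 hp)
  exact measure_mono_null (fun x hx ↦ Submodule.inner_left_of_mem_orthogonal hx hu)
    (stdGaussian_hyperplane hu0)

/-- The coordinates of a standard Gaussian vector along two orthonormal vectors are independent
standard Gaussian variables. -/
lemma stdGaussian_map_inner_inner {u w : E} (hu : ‖u‖ = 1) (hw : ‖w‖ = 1) (huw : ⟪u, w⟫ = 0) :
    (ProbabilityTheory.stdGaussian E).map (fun x ↦ (⟪u, x⟫, ⟪w, x⟫)) =
      (gaussianReal 0 1).prod (gaussianReal 0 1) := by
  have hli : LinearIndependent ℝ ![u, w] := by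
    refine Orthonormal.linearIndependent (𝕜 := ℝ) ⟨?_, ?_⟩
    · simp [Fin.forall_fin_two, hu, hw]
    · intro i j hij
      fin_cases i <;> fin_cases j <;> simp_all [real_inner_comm]
  have hcard : 2 ≤ finrank ℝ E := by simpa using hli.fintype_card_le_finrank
  have hij : (⟨0, by lia⟩ : Fin (finrank ℝ E)) ≠ ⟨1, by lia⟩ := by simp
  obtain ⟨b, hb₀, hb₁⟩ := exists_orthonormalBasis_apply_eq_apply_eq hu hw huw hij
  rw [stdGaussian_eq_map_pi_orthonormalBasis b, Measure.map_map (by fun_prop) (by fun_prop)]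
  have hcomp : (fun x ↦ (⟪u, x⟫, ⟪w, x⟫)) ∘ (fun x : Fin (finrank ℝ E) → ℝ ↦ ∑ i, x i • b i) =
      fun x ↦ (x ⟨0, by lia⟩, x ⟨1, by lia⟩) := by
    ext x <;> simp only [Function.comp_apply, ← hb₀, ← hb₁, b.orthonormal.inner_right_fintype]
  have hind := (iIndepFun_pi (μ := fun _ : Fin (finrank ℝ E) ↦ gaussianReal 0 1)
    (X := fun _ x ↦ x) fun _ ↦ aemeasurable_id).indepFun hij
  rw [hcomp, hind.map_prod_eq_prod_map_map (measurable_pi_apply _).aemeasurable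
    (measurable_pi_apply _).aemeasurable]
  congr 1
  · exact (measurePreserving_eval (fun _ : Fin (finrank ℝ E) ↦ gaussianReal 0 1) _).map_eq
  · exact (measurePreserving_eval (fun _ : Fin (finrank ℝ E) ↦ gaussianReal 0 1) _).map_eq

/-- The Gaussian measure of the intersection of two slabs of width `ε` whose unit normals enclose an
angle with sine `√(1 - ⟪u, v⟫ ^ 2)`. -/
lemma stdGaussian_inter_slabs_le {u v : E} (hu : ‖u‖ = 1) (hv : ‖v‖ = 1)
    (huv : 0 < 1 - ⟪u, v⟫ ^ 2) (a b : ℝ) {ε : ℝ} (hε : 0 < ε) :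
    ProbabilityTheory.stdGaussian E {x | |⟪u, x⟫ - a| ≤ ε / 2 ∧ |⟪v, x⟫ - b| ≤ ε / 2} ≤
      ENNReal.ofReal (ε ^ 2 / (2 * Real.pi * √(1 - ⟪u, v⟫ ^ 2))) := by
  set c := ⟪u, v⟫ with hc
  set σ := √(1 - c ^ 2) with hσ
  have hσ0 : 0 < σ := Real.sqrt_pos.2 huv
  have hσsq : σ ^ 2 = 1 - c ^ 2 := Real.sq_sqrt huv.le
  set w := σ⁻¹ • (v - c • u) with hw
  have huw : ⟪u, w⟫ = 0 := by
    simp [hw, real_inner_smul_right, inner_sub_right, hu, ← hc]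
  have hvw : v = c • u + σ • w := by
    rw [hw, smul_smul, mul_inv_cancel₀ hσ0.ne', one_smul]
    abel
  have hw1 : ‖w‖ = 1 := by
    have h1 : ‖v - c • u‖ ^ 2 = σ ^ 2 := by
      rw [norm_sub_sq_real, real_inner_smul_right, real_inner_comm, ← hc, norm_smul, hu, hv,
        hσsq, Real.norm_eq_abs, mul_one, sq_abs]
      ring
    rw [hw, norm_smul, (sq_eq_sq₀ (norm_nonneg _) hσ0.le).1 h1, norm_inv, Real.norm_eq_abs,
      abs_of_pos hσ0, inv_mul_cancel₀ hσ0.ne']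
  set A : Set (ℝ × ℝ) := 
    {p | |p.1 - a| ≤ ε / 2} ∩ {p | |c * p.1 + σ * p.2 - b| ≤ ε / 2} with hA
  have hAmeas : MeasurableSet A :=
    (measurableSet_le (by fun_prop) (by fun_prop)).inter
      (measurableSet_le (by fun_prop) (by fun_prop))
  have hpre : {x : E | |⟪u, x⟫ - a| ≤ ε / 2 ∧ |⟪v, x⟫ - b| ≤ ε / 2} =
      (fun x ↦ (⟪u, x⟫, ⟪w, x⟫)) ⁻¹' A := by
    ext x
    have : ⟪v, x⟫ = c * ⟪u, x⟫ + σ * ⟪w, x⟫ := by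
      conv_lhs => rw [hvw]
      rw [inner_add_left, real_inner_smul_left, real_inner_smul_left]
    simp [hA, this]
  rw [hpre, ← Measure.map_apply (by fun_prop) hAmeas, stdGaussian_map_inner_inner hu hw1 huw,
    Measure.prod_apply hAmeas]
  have hsection (x : ℝ) : gaussianReal 0 1 (Prod.mk x ⁻¹' A) ≤
      (Set.Icc (a - ε / 2) (a + ε / 2)).indicator
        (fun _ ↦ ENNReal.ofReal (ε / σ / √(2 * Real.pi))) x := by
    by_cases hx : x ∈ Set.Icc (a - ε / 2) (a + ε / 2)
    · rw [Set.indicator_of_mem hx]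
      have hsub : Prod.mk x ⁻¹' A ⊆
          Set.Icc ((b - c * x - ε / 2) / σ) ((b - c * x + ε / 2) / σ) := by
        rintro y ⟨-, hy⟩
        replace hy := abs_le.1 (Set.mem_ofPred_eq ▸ hy)
        rw [Set.mem_Icc, div_le_iff₀ hσ0, le_div_iff₀ hσ0]
        constructor <;> linarith [hy.1, hy.2]
      refine (measure_mono hsub).trans ((gaussianReal_Icc_le _ _).trans_eq ?_)
      congr 2
      ring
    · have : Prod.mk x ⁻¹' A = ∅ := by
        refine Set.eq_empty_of_forall_notMem fun y hy ↦ hx ?_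
        have := abs_le.1 (Set.mem_ofPred_eq ▸ hy.1)
        constructor <;> linarith [this.1, this.2]
      simp [this]
  refine (lintegral_mono hsection).trans ?_
  rw [lintegral_indicator measurableSet_Icc, setLIntegral_const]
  refine (mul_le_mul_right (gaussianReal_Icc_le _ _) _).trans_eq ?_
  rw [← ENNReal.ofReal_mul (by positivity)]
  congr 1
  have h2 : √(2 * Real.pi) * √(2 * Real.pi) = 2 * Real.pi := Real.mul_self_sqrt (by positivity)
  generalize √(2 * Real.pi) = q at h2 ⊢
  rw [← h2]
  ring

/-- A Gaussian vector is unlikely to lie in a narrow double cone around a given axis. -/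
lemma stdGaussian_cone_le (hE : 3 ≤ finrank ℝ E) {u : E} (hu : u ≠ 0) {t : ℝ} (ht : 1 ≤ t) :
    ProbabilityTheory.stdGaussian E {g | NearlyParallel t u g} ≤
      ENNReal.ofReal (1 / t ^ (finrank ℝ E - 2)) := by
  unfold NearlyParallel
  have ht0 : 0 < t := by linarith
  have hu' : 0 < ‖u‖ := norm_pos_iff.2 hu
  set i₀ : Fin (finrank ℝ E) := ⟨0, by lia⟩
  obtain ⟨b, hb⟩ := exists_orthonormalBasis_apply_eq (u := ‖u‖⁻¹ • u)
    (by simp [norm_smul, hu'.ne']) i₀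
  have hub : u = ‖u‖ • b i₀ := by rw [hb, smul_smul, mul_inv_cancel₀ hu'.ne', one_smul]
  have hmeas : MeasurableSet
      {g : E | (1 - 1 / (2 * Real.pi * t ^ 2)) * (‖u‖ ^ 2 * ‖g‖ ^ 2) ≤ ⟪u, g⟫ ^ 2} :=
    (isClosed_le (by fun_prop) (by fun_prop)).measurableSet
  rw [stdGaussian_eq_map_pi_orthonormalBasis b, Measure.map_apply (by fun_prop) hmeas]
  set κ : ℝ := (2 * Real.pi * t ^ 2 - 1) / 4 with hκ
  have hpit : 3 < Real.pi * t ^ 2 := by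
    nlinarith [Real.pi_gt_three, one_le_pow₀ (n := 2) ht]
  set c : Fin (finrank ℝ E) → ℝ := fun i ↦ if i = i₀ then -1 / 4 else κ with hc
  have hsub : (fun x : Fin (finrank ℝ E) → ℝ ↦ ∑ i, x i • b i) ⁻¹'
      {g : E | (1 - 1 / (2 * Real.pi * t ^ 2)) * (‖u‖ ^ 2 * ‖g‖ ^ 2) ≤ ⟪u, g⟫ ^ 2} ⊆
      {x | 1 ≤ ∏ i, ENNReal.ofReal (Real.exp (-c i * x i ^ 2))} := by
    intro x hx
    have hin : ⟪u, ∑ i, x i • b i⟫ = ‖u‖ * x i₀ := by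
      conv_lhs => rw [hub]
      rw [real_inner_smul_left, b.orthonormal.inner_right_fintype]
    have hnorm : ‖∑ i, x i • b i‖ ^ 2 = ∑ i, x i ^ 2 := by
      rw [← real_inner_self_eq_norm_sq, b.orthonormal.inner_sum]
      simp [sq]
    rw [Set.mem_preimage, Set.mem_ofPred_eq, hin, hnorm, mul_pow, mul_left_comm,
      mul_le_mul_iff_right₀ (by positivity),
      ← Finset.add_sum_erase _ _ (Finset.mem_univ i₀)] at hx
    rw [Set.mem_ofPred_eq, ← ENNReal.ofReal_prod_of_nonneg fun _ _ ↦ (Real.exp_pos _).le,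
      ← Real.exp_sum, ENNReal.one_le_ofReal, Real.one_le_exp_iff,
      ← Finset.add_sum_erase _ _ (Finset.mem_univ i₀),
      Finset.sum_congr rfl (g := fun i ↦ -κ * x i ^ 2)
        fun i hi ↦ by simp [hc, Finset.ne_of_mem_erase hi],
      ← Finset.mul_sum]
    simp only [hc, if_true, hκ]
    set R := ∑ i ∈ Finset.univ.erase i₀, x i ^ 2
    have hx' : (2 * Real.pi * t ^ 2) * ((1 - 1 / (2 * Real.pi * t ^ 2)) * (x i₀ ^ 2 + R)) ≤
      (2 * Real.pi * t ^ 2) * x i₀ ^ 2 := by gcongr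
    have hne : 2 * Real.pi * t ^ 2 ≠ 0 := by positivity
    rw [← mul_assoc, mul_sub, mul_one_div_cancel hne, mul_one] at hx'
    linarith
  refine (measure_mono hsub).trans ?_
  have hmarkov := mul_meas_ge_le_lintegral
    (μ := Measure.pi fun _ : Fin (finrank ℝ E) ↦ gaussianReal 0 1)
    (f := fun x ↦ ∏ i, ENNReal.ofReal (Real.exp (-c i * x i ^ 2))) (by fun_prop) 1
  rw [one_mul] at hmarkov
  refine hmarkov.trans ?_
  have hind := iIndepFun_pi (μ := fun _ : Fin (finrank ℝ E) ↦ gaussianReal 0 1)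
    (X := fun i x ↦ ENNReal.ofReal (Real.exp (-c i * x ^ 2))) fun _ ↦ by fun_prop
  rw [lintegral_prod_eq_prod_lintegral_of_indepFun _ _ hind fun _ ↦ by fun_prop]
  have hc1 (i) : 0 < 1 + 2 * c i := by
    by_cases hi : i = i₀
    · norm_num [hc, hi]
    · simp only [hc, hi, if_false, hκ]
      linarith
  have hfactor (i) : ∫⁻ x, ENNReal.ofReal (Real.exp (-c i * x i ^ 2))
      ∂(Measure.pi fun _ : Fin (finrank ℝ E) ↦ gaussianReal 0 1) =
      ENNReal.ofReal (1 / √(1 + 2 * c i)) := by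
    rw [← lintegral_exp_neg_mul_sq_gaussianReal (hc1 i)]
    exact (measurePreserving_eval (fun _ : Fin (finrank ℝ E) ↦ gaussianReal 0 1) i).lintegral_comp
      (f := fun y ↦ ENNReal.ofReal (Real.exp (-c i * y ^ 2))) (by fun_prop)
  simp_rw [hfactor]
  rw [← ENNReal.ofReal_prod_of_nonneg fun _ _ ↦ by positivity]
  refine ENNReal.ofReal_le_ofReal ?_
  rw [← Finset.mul_prod_erase _ _ (Finset.mem_univ i₀)]
  have hrest : ∏ i ∈ Finset.univ.erase i₀, 1 / √(1 + 2 * c i) ≤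
      (1 / (√Real.pi * t)) ^ (finrank ℝ E - 1) := by
    have hcard : (Finset.univ.erase i₀).card = finrank ℝ E - 1 := by simp
    rw [← hcard, ← Finset.prod_const]
    refine Finset.prod_le_prod (fun _ _ ↦ by positivity) fun i hi ↦ ?_
    refine one_div_le_one_div_of_le (by positivity) (Real.le_sqrt_of_sq_le ?_)
    simp only [hc, Finset.ne_of_mem_erase hi, if_false, hκ]
    rw [mul_pow, Real.sq_sqrt Real.pi_pos.le]
    linarith
  have hfirst : 1 / √(1 + 2 * c i₀) ≤ 2 := by
    rw [one_div]
    refine inv_le_of_inv_le₀ (by norm_num) (Real.le_sqrt_of_sq_le ?_)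
    norm_num [hc]
  obtain ⟨k, hk⟩ := Nat.exists_eq_add_of_le hE
  have hpi : (1 / √Real.pi) ^ (k + 2) ≤ 1 / 3 := by
    have h1 : 1 / √Real.pi ≤ 1 := by
      rw [div_le_one (by positivity), Real.one_le_sqrt]
      linarith [Real.pi_gt_three]
    refine (pow_le_pow_of_le_one (by positivity) h1 (by lia : 2 ≤ k + 2)).trans ?_
    rw [div_pow, Real.sq_sqrt Real.pi_pos.le, one_pow]
    exact one_div_le_one_div_of_le (by norm_num) Real.pi_gt_three.le
  have htk : (1 / t) ^ (k + 2) ≤ (1 / t) ^ (k + 1) :=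
    pow_le_pow_of_le_one (by positivity) ((div_le_one ht0).2 ht) (by lia)
  calc _ ≤ 2 * (1 / (√Real.pi * t)) ^ (finrank ℝ E - 1) := by gcongr
    _ = 2 * ((1 / √Real.pi) ^ (k + 2) * (1 / t) ^ (k + 2)) := by
      rw [← mul_pow, div_mul_div_comm, one_mul, show finrank ℝ E - 1 = k + 2 by lia]
    _ ≤ 2 * (1 / 3 * (1 / t) ^ (k + 1)) := by gcongr
    _ ≤ (1 / t) ^ (k + 1) := by
      have : 0 ≤ (1 / t) ^ (k + 1) := by positivity
      linarith
    _ = 1 / t ^ (finrank ℝ E - 2) := by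
      rw [one_div_pow, show finrank ℝ E - 2 = k + 1 by lia]

/-- At most `dim E` independent standard Gaussian vectors are almost surely linearly independent. -/
lemma ae_linearIndependent_stdGaussian {k : ℕ} (hk : k ≤ finrank ℝ E) :
    ∀ᵐ S ∂(Measure.pi fun _ : Fin k ↦ ProbabilityTheory.stdGaussian E), LinearIndependent ℝ S := by
  induction k with
  | zero => exact .of_forall fun S ↦ linearIndependent_empty_type
  | succ k ih =>
    have hmeas : MeasurableSet {S : Fin (k + 1) → E | ¬ LinearIndependent ℝ S} :=
      (isOpen_setOfPred_linearIndependent (𝕜 := ℝ)).measurableSet.compl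
    set e := MeasurableEquiv.piFinSuccAbove (fun _ : Fin (k + 1) ↦ E) 0
    have he := (measurePreserving_piFinSuccAbove
      (fun _ : Fin (k + 1) ↦ ProbabilityTheory.stdGaussian E) 0).symm
    rw [ae_iff, ← he.measure_preimage hmeas.nullMeasurableSet,
      Measure.prod_apply_symm (he.measurable hmeas), lintegral_eq_zero_iff
        (measurable_measure_prodMk_right (he.measurable hmeas))]
    filter_upwards [ih (by lia)] with S hS
    have hspan : Submodule.span ℝ (Set.range S) ≠ ⊤ := by
      intro h
      have := finrank_range_le_card (R := ℝ) S
      rw [Set.finrank, h, finrank_top, Fintype.card_fin] at this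
      lia
    refine measure_mono_null (fun x hx ↦ ?_) (stdGaussian_submodule hspan)
    by_contra hxS
    refine hx ?_
    have : e.symm (x, S) = Fin.cons x S := Fin.insertNth_zero' x S
    rw [this]
    exact linearIndependent_finCons.2 ⟨hS, hxS⟩

end StandardGaussian

section NormalVector

variable {d : ℕ}

/-- The vector `n` with `⟪n, S i⟫ = 1` for all `i`, a normal vector of the affine hull of the
linearly independent vectors `S i`. -/
noncomputable def affineNormal (S : Fin d → EuclideanSpace ℝ (Fin d)) : EuclideanSpace ℝ (Fin d) :=
  WithLp.toLp 2 ((Matrix.of fun i ↦ (S i).ofLp)⁻¹.mulVec 1)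

lemma isUnit_of_linearIndependent {S : Fin d → EuclideanSpace ℝ (Fin d)}
    (hS : LinearIndependent ℝ S) : IsUnit (Matrix.of fun i ↦ (S i).ofLp) :=
  Matrix.linearIndependent_rows_iff_isUnit.1
    (hS.map' (WithLp.linearEquiv 2 ℝ (Fin d → ℝ)).toLinearMap (LinearEquiv.ker _))

lemma inner_eq_mulVec (S : Fin d → EuclideanSpace ℝ (Fin d)) (n : EuclideanSpace ℝ (Fin d))
    (i : Fin d) : ⟪n, S i⟫ = (Matrix.of fun i ↦ (S i).ofLp).mulVec n.ofLp i := by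
  simp [Matrix.mulVec, dotProduct, PiLp.inner_apply]

lemma inner_affineNormal {S : Fin d → EuclideanSpace ℝ (Fin d)} (hS : LinearIndependent ℝ S)
    (i : Fin d) : ⟪affineNormal S, S i⟫ = 1 := by
  rw [inner_eq_mulVec, affineNormal, Matrix.mulVec_mulVec, Matrix.mul_nonsing_inv _
    ((Matrix.isUnit_iff_isUnit_det _).1 (isUnit_of_linearIndependent hS)), Matrix.one_mulVec,
    Pi.one_apply]

lemma affineNormal_eq {S : Fin d → EuclideanSpace ℝ (Fin d)} (hS : LinearIndependent ℝ S)
    {n : EuclideanSpace ℝ (Fin d)} (hn : ∀ i, ⟪n, S i⟫ = 1) : affineNormal S = n := by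
  have h : (Matrix.of fun i ↦ (S i).ofLp).mulVec n.ofLp = 1 :=
    funext fun i ↦ (inner_eq_mulVec S n i).symm.trans (hn i)
  rw [affineNormal, ← h, Matrix.mulVec_mulVec, Matrix.nonsing_inv_mul _
    ((Matrix.isUnit_iff_isUnit_det _).1 (isUnit_of_linearIndependent hS)), Matrix.one_mulVec]

lemma affineNormal_ne_zero [NeZero d] {S : Fin d → EuclideanSpace ℝ (Fin d)}
    (hS : LinearIndependent ℝ S) : affineNormal S ≠ 0 := by
  intro h
  simpa [h] using inner_affineNormal hS 0

lemma affineNormal_map {S : Fin d → EuclideanSpace ℝ (Fin d)} (hS : LinearIndependent ℝ S)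
    (A : EuclideanSpace ℝ (Fin d) ≃ₗᵢ[ℝ] EuclideanSpace ℝ (Fin d)) :
    affineNormal (fun i ↦ A (S i)) = A (affineNormal S) :=
  affineNormal_eq (hS.map' A.toLinearEquiv.toLinearMap (LinearEquiv.ker _)) fun i ↦
    (A.inner_map_map _ _).trans (inner_affineNormal hS i)

lemma measurable_affineNormal :
    Measurable (affineNormal : (Fin d → EuclideanSpace ℝ (Fin d)) → _) := by
  have hM : Continuous fun S : Fin d → EuclideanSpace ℝ (Fin d) ↦ Matrix.of fun i ↦ (S i).ofLp :=
    continuous_matrix fun i j ↦ by simp only [Matrix.of_apply]; fun_prop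
  have hdet := hM.matrix_det.measurable.inv
  have hadj := (hM.matrix_adjugate.matrix_mulVec
    (continuous_const (y := (1 : Fin d → ℝ)))).measurable
  refine (WithLp.measurable_toLp 2 (Fin d → ℝ)).comp ?_
  simp only [Matrix.inv_def, Ring.inverse_eq_inv', Matrix.smul_mulVec]
  exact hdet.smul hadj

end NormalVector

section RandomHyperplanes

variable {d : ℕ}

lemma measurableSet_nearlyParallel (t : ℝ) :
    MeasurableSet {p : (Fin d → EuclideanSpace ℝ (Fin d)) × EuclideanSpace ℝ (Fin d) |
      NearlyParallel t (affineNormal p.1) p.2} := by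
  have h : Measurable fun p : (Fin d → EuclideanSpace ℝ (Fin d)) × EuclideanSpace ℝ (Fin d) ↦
      affineNormal p.1 := measurable_affineNormal.comp measurable_fst
  exact measurableSet_le (by fun_prop) ((h.inner measurable_snd).pow_const 2)

/-- By rotation invariance, the probability that a random normal is nearly parallel to `v` is at
most its value for any other nonzero vector. -/
lemma measure_nearlyParallel_affineNormal_le (t : ℝ) {v w : EuclideanSpace ℝ (Fin d)}
    (hv : v ≠ 0) (hw : w ≠ 0) :
    (Measure.pi fun _ : Fin d ↦ ProbabilityTheory.stdGaussian (EuclideanSpace ℝ (Fin d)))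
        {S | NearlyParallel t (affineNormal S) v} ≤
      (Measure.pi fun _ : Fin d ↦ ProbabilityTheory.stdGaussian (EuclideanSpace ℝ (Fin d)))
        {S | NearlyParallel t (affineNormal S) w} := by
  have hv' : ‖v‖ ≠ 0 := norm_ne_zero_iff.2 hv
  have hw' : ‖w‖ ≠ 0 := norm_ne_zero_iff.2 hw
  set c := ‖w‖ / ‖v‖
  have hnorm : ‖c • v‖ = ‖w‖ := by
    rw [norm_smul, norm_div, norm_norm, norm_norm, div_mul_cancel₀ _ hv']
  set A := (ℝ ∙ (c • v - w))ᗮ.reflection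
  have hA : A (c • v) = w := Submodule.reflection_sub hnorm
  have hpres := measurePreserving_pi
    (fun _ : Fin d ↦ ProbabilityTheory.stdGaussian (EuclideanSpace ℝ (Fin d)))
    (fun _ : Fin d ↦ ProbabilityTheory.stdGaussian (EuclideanSpace ℝ (Fin d)))
    (f := fun _ ↦ A) fun _ ↦ ⟨A.continuous.measurable, stdGaussian_map A⟩
  have hmeas : MeasurableSet {S : Fin d → EuclideanSpace ℝ (Fin d) |
      NearlyParallel t (affineNormal S) w} :=
    measurable_prodMk_right (measurableSet_nearlyParallel t)
  rw [← hpres.measure_preimage hmeas.nullMeasurableSet]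
  refine measure_mono_ae ?_
  filter_upwards [ae_linearIndependent_stdGaussian (E := EuclideanSpace ℝ (Fin d)) (k := d)
    (by simp)] with S hS h
  change NearlyParallel t (affineNormal fun i ↦ A (S i)) w
  rw [affineNormal_map hS, ← hA]
  exact (NearlyParallel.smul_right h c).map A

lemma measure_nearlyParallel_affineNormal_le_ofReal (hd : 3 ≤ d) {t : ℝ} (ht : 1 ≤ t)
    {v : EuclideanSpace ℝ (Fin d)} (hv : v ≠ 0) :
    (Measure.pi fun _ : Fin d ↦ ProbabilityTheory.stdGaussian (EuclideanSpace ℝ (Fin d)))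
        {S | NearlyParallel t (affineNormal S) v} ≤ ENNReal.ofReal (1 / t ^ (d - 2)) := by
  have : NeZero d := ⟨by lia⟩
  set γ := ProbabilityTheory.stdGaussian (EuclideanSpace ℝ (Fin d))
  set P := Measure.pi fun _ : Fin d ↦ γ
  have hmeas := measurableSet_nearlyParallel (d := d) t
  calc P {S | NearlyParallel t (affineNormal S) v}
      = ∫⁻ _, P {S | NearlyParallel t (affineNormal S) v} ∂γ := by simp
    _ ≤ ∫⁻ g, P {S | NearlyParallel t (affineNormal S) g} ∂γ := by
      refine lintegral_mono_ae ?_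
      have h0 : ∀ᵐ g ∂γ, g ≠ 0 := by
        have : Nontrivial (EuclideanSpace ℝ (Fin d)) := ⟨v, 0, hv⟩
        rw [ae_iff]
        exact measure_mono_null (fun x hx ↦ by simpa using hx)
          (stdGaussian_submodule (p := (⊥ : Submodule ℝ (EuclideanSpace ℝ (Fin d)))) bot_ne_top)
      filter_upwards [h0] with g hg
      exact measure_nearlyParallel_affineNormal_le t hv hg
    _ = P.prod γ {p | NearlyParallel t (affineNormal p.1) p.2} :=
      (Measure.prod_apply_symm hmeas).symm
    _ = ∫⁻ S, γ {g | NearlyParallel t (affineNormal S) g} ∂P := Measure.prod_apply hmeas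
    _ ≤ ∫⁻ _, ENNReal.ofReal (1 / t ^ (d - 2)) ∂P := by
      refine lintegral_mono_ae ?_
      filter_upwards [ae_linearIndependent_stdGaussian (E := EuclideanSpace ℝ (Fin d)) (k := d)
        (by simp)] with S hS
      simpa using stdGaussian_cone_le (by simpa using hd) (affineNormal_ne_zero hS) ht
    _ = ENNReal.ofReal (1 / t ^ (d - 2)) := by simp

lemma nearlyParallel_of_le_stdGaussian_inter [NeZero d] {S T : Fin d → EuclideanSpace ℝ (Fin d)}
    (hS : LinearIndependent ℝ S) (hT : LinearIndependent ℝ T) {ε t : ℝ} (hε : 0 < ε) (ht : 1 ≤ t)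
    (h : ENNReal.ofReal (ε ^ 2 * t / √(2 * Real.pi)) ≤
      ProbabilityTheory.stdGaussian (EuclideanSpace ℝ (Fin d))
        (Metric.cthickening (ε / 2) (affineSpan ℝ (Set.range S) : Set _) ∩
          Metric.cthickening (ε / 2) (affineSpan ℝ (Set.range T) : Set _))) :
    NearlyParallel t (affineNormal S) (affineNormal T) := by
  have ht0 : 0 < t := by linarith
  have hu : 0 < ‖affineNormal S‖ := norm_pos_iff.2 (affineNormal_ne_zero hS)
  have hv : 0 < ‖affineNormal T‖ := norm_pos_iff.2 (affineNormal_ne_zero hT)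
  by_contra hpar
  rw [NearlyParallel, not_le] at hpar
  have hu1 : ‖‖affineNormal S‖⁻¹ • affineNormal S‖ = 1 := by simp [norm_smul, hu.ne']
  have hv1 : ‖‖affineNormal T‖⁻¹ • affineNormal T‖ = 1 := by simp [norm_smul, hv.ne']
  have hinner : ⟪‖affineNormal S‖⁻¹ • affineNormal S, ‖affineNormal T‖⁻¹ • affineNormal T⟫ ^ 2 <
      1 - 1 / (2 * Real.pi * t ^ 2) := by
    rw [real_inner_smul_left, real_inner_smul_right, ← mul_assoc, ← mul_inv, inv_mul_eq_div,
      div_pow, div_lt_iff₀ (by positivity), mul_pow]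
    exact hpar
  have hpos : 0 < 1 / (2 * Real.pi * t ^ 2) := by positivity
  have hslab := stdGaussian_inter_slabs_le hu1 hv1 (by linarith)
    (‖affineNormal S‖⁻¹) (‖affineNormal T‖⁻¹) hε
  have hsub := Set.inter_subset_inter
    (cthickening_affineSpan_subset_slab (S := S) hu1 (a := ‖affineNormal S‖⁻¹)
      (fun i ↦ by rw [real_inner_smul_left, inner_affineNormal hS, mul_one]) (half_pos hε).le)
    (cthickening_affineSpan_subset_slab (S := T) hv1 (a := ‖affineNormal T‖⁻¹)
      (fun i ↦ by rw [real_inner_smul_left, inner_affineNormal hT, mul_one]) (half_pos hε).le)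
  have hle := (h.trans (measure_mono hsub)).trans hslab
  set r := ⟪‖affineNormal S‖⁻¹ • affineNormal S, ‖affineNormal T‖⁻¹ • affineNormal T⟫
  have hσ : 1 / (√(2 * Real.pi) * t) < √(1 - r ^ 2) := by
    refine Real.lt_sqrt_of_sq_lt ?_
    rw [div_pow, mul_pow, Real.sq_sqrt (by positivity), one_pow]
    linarith
  refine hle.not_gt ((ENNReal.ofReal_lt_ofReal_iff (by positivity)).2 ?_)
  have hσ0 : 0 < √(1 - r ^ 2) := lt_trans (by positivity) hσ
  rw [div_lt_iff₀ (by positivity)] at hσ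
  rw [div_lt_div_iff₀ (by positivity) (by positivity)]
  have h2 : √(2 * Real.pi) * √(2 * Real.pi) = 2 * Real.pi := Real.mul_self_sqrt (by positivity)
  calc ε ^ 2 * √(2 * Real.pi) = ε ^ 2 * √(2 * Real.pi) * 1 := by ring
    _ < ε ^ 2 * √(2 * Real.pi) * (√(1 - r ^ 2) * (√(2 * Real.pi) * t)) := by gcongr
    _ = ε ^ 2 * t * ((√(2 * Real.pi) * √(2 * Real.pi)) * √(1 - r ^ 2)) := by ring
    _ = ε ^ 2 * t * (2 * Real.pi * √(1 - r ^ 2)) := by rw [h2]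

end RandomHyperplanes

lemma stdGaussian_eq (d : ℕ) :
    _root_.stdGaussian d = ProbabilityTheory.stdGaussian (EuclideanSpace ℝ (Fin d)) :=
  map_pi_eq_stdGaussian

/-- Lemma: let `d ≥ 1` and let `S₁, …, S_d, T₁, …, T_d` be `2d` iid standard Gaussian vectors
in `ℝ^d`. Let `B_S`, `B_T` be the `(ε/2)`-neighborhoods of `aff{S₁,…,S_d}` and
`aff{T₁,…,T_d}`. Then for every `t ≥ 1`, `ℙ(𝒢(B_S ∩ B_T) ≥ ε² t/√(2π)) ≤ 1/t^{d-2}`. -/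
theorem stmt18 (d : ℕ) (hd : 1 ≤ d) (ε : ℝ) (hε : 0 < ε) (t : ℝ) (ht : 1 ≤ t) :
    (Measure.pi fun _ : Fin d ⊕ Fin d => stdGaussian d)
        {ω : Fin d ⊕ Fin d → EuclideanSpace ℝ (Fin d) |
          ENNReal.ofReal (ε ^ 2 * t / Real.sqrt (2 * Real.pi)) ≤
            stdGaussian d
              (Metric.cthickening (ε / 2)
                  (affineSpan ℝ (Set.range fun i : Fin d => ω (Sum.inl i)) :
                    Set (EuclideanSpace ℝ (Fin d))) ∩
                Metric.cthickening (ε / 2)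
                  (affineSpan ℝ (Set.range fun i : Fin d => ω (Sum.inr i)) :
                    Set (EuclideanSpace ℝ (Fin d))))} ≤
      ENNReal.ofReal (1 / t ^ (d - 2)) := by
  simp_rw [stdGaussian_eq]
  rcases lt_or_ge d 3 with hd3 | hd3
  · rw [show d - 2 = 0 by lia]
    simpa using prob_le_one
  have : NeZero d := ⟨by lia⟩
  set γ := ProbabilityTheory.stdGaussian (EuclideanSpace ℝ (Fin d))
  set P := Measure.pi fun _ : Fin d ↦ γ
  have hli : ∀ᵐ S ∂P, LinearIndependent ℝ S := ae_linearIndependent_stdGaussian (by simp)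
  have hsum := measurePreserving_sumPiEquivProdPi (fun _ : Fin d ⊕ Fin d ↦ γ)
  set B : Set ((Fin d → EuclideanSpace ℝ (Fin d)) × (Fin d → EuclideanSpace ℝ (Fin d))) :=
    {p | NearlyParallel t (affineNormal p.1) (affineNormal p.2)}
  have hB : MeasurableSet B :=
    (measurable_fst.prodMk (measurable_affineNormal.comp measurable_snd))
      (measurableSet_nearlyParallel t)
  calc _ ≤ Measure.pi (fun _ : Fin d ⊕ Fin d ↦ γ)
        (MeasurableEquiv.sumPiEquivProdPi (fun _ : Fin d ⊕ Fin d ↦ EuclideanSpace ℝ (Fin d)) ⁻¹'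
          B) := by
        refine measure_mono_ae ?_
        have hfst := (Measure.quasiMeasurePreserving_fst.comp hsum.quasiMeasurePreserving).ae hli
        have hsnd := (Measure.quasiMeasurePreserving_snd.comp hsum.quasiMeasurePreserving).ae hli
        filter_upwards [hfst, hsnd] with ω hS hT h
        exact nearlyParallel_of_le_stdGaussian_inter hS hT hε ht h
    _ = P.prod P B := hsum.measure_preimage hB.nullMeasurableSet
    _ = ∫⁻ T, P {S | NearlyParallel t (affineNormal S) (affineNormal T)} ∂P :=
        Measure.prod_apply_symm hB
    _ ≤ ∫⁻ _, ENNReal.ofReal (1 / t ^ (d - 2)) ∂P := by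
        refine lintegral_mono_ae ?_
        filter_upwards [hli] with T hT
        exact measure_nearlyParallel_affineNormal_le_ofReal hd3 ht (affineNormal_ne_zero hT)
    _ = ENNReal.ofReal (1 / t ^ (d - 2)) := by simp
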